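/- Suppose in addition that every vertex of H outside S0 lies in B_1 ∪ ... ∪ B_5 (i.e. V(H) = S0 ∪ B_1 ∪ ... ∪ B_5), that |B_j| = t for every j ∈ {1,...,5}, where t ≥ 1, and that for every j ∈ {1,...,5} (indices modulo 5) there is at least one edge between B_j and B_{j+1}. Then the independence number of H equals 2t + 2. -/

import Mathlib

open SimpleGraph

/-- The disjoint union `P2 ∪ P3`: an edge 0-1 together with a path 2-3-4. -/
def p2p3 : SimpleGraph (Fin 5) :=
  SimpleGraph.fromEdgeSet {s(0,1), s(2,3), s(3,4)}

variable {V : Type*}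

/-- `S0` is the vertex set of the induced 5-cycle. -/
def S0 (v : Fin 5 → V) : Set V := Set.range v

/-- `Aset H v i` is the set of vertices outside `S0` whose neighborhood in `S0`
is exactly `{v i}`. -/
def Aset (H : SimpleGraph V) (v : Fin 5 → V) (i : Fin 5) : Set V :=
  {x | x ∉ S0 v ∧ ∀ j : Fin 5, H.Adj x (v j) ↔ j = i}

/-- `Bset H v i` is the set of vertices outside `S0` whose neighborhood in `S0`
is exactly `{v (i-1), v (i+1)}`. -/
def Bset (H : SimpleGraph V) (v : Fin 5 → V) (i : Fin 5) : Set V :=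
  {x | x ∉ S0 v ∧ ∀ j : Fin 5, H.Adj x (v j) ↔ (j = i - 1 ∨ j = i + 1)}

/-- `S2set H v` is the set of vertices at distance exactly 2 from `S0`: vertices outside `S0`
with no neighbor in `S0` but with a neighbor having a neighbor in `S0`. -/
def S2set (H : SimpleGraph V) (v : Fin 5 → V) : Set V :=
  {x | x ∉ S0 v ∧ (∀ j : Fin 5, ¬ H.Adj x (v j)) ∧
    ∃ y, H.Adj x y ∧ ∃ j : Fin 5, H.Adj y (v j)}

/-- `S` is complete to `T`: every vertex of `S` is adjacent to every vertex of `T`. -/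
def Complete (H : SimpleGraph V) (S T : Set V) : Prop := ∀ x ∈ S, ∀ y ∈ T, H.Adj x y

/-- `S` is anticomplete to `T`: there are no edges between `S` and `T`. -/
def Anticomplete (H : SimpleGraph V) (S T : Set V) : Prop := ∀ x ∈ S, ∀ y ∈ T, ¬ H.Adj x y

/-- `hA` is the number of indices `i` with `A_i` nonempty. -/
noncomputable def hA (H : SimpleGraph V) (v : Fin 5 → V) : ℕ :=
  {i : Fin 5 | (Aset H v i).Nonempty}.ncard

/-- `hB` is the number of indices `i` with `B_i` nonempty. -/
noncomputable def hB (H : SimpleGraph V) (v : Fin 5 → V) : ℕ :=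
  {i : Fin 5 | (Bset H v i).Nonempty}.ncard

/-- The vertices `a b` of an edge and `c d e` of an induced path with no edges in between
cannot occur in a `P2 ∪ P3`-free graph. -/
theorem not_edge_and_path {V : Type*} {H : SimpleGraph V} (hP2P3 : ¬ Nonempty (p2p3 ↪g H))
    {a b c d e : V} (hab : H.Adj a b) (hcd : H.Adj c d) (hde : H.Adj d e) (hce : ¬ H.Adj c e)
    (hne : c ≠ e) (hac : ¬ H.Adj a c) (had : ¬ H.Adj a d) (hae : ¬ H.Adj a e)
    (hbc : ¬ H.Adj b c) (hbd : ¬ H.Adj b d) (hbe : ¬ H.Adj b e) : False := by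
  apply hP2P3
  have hadj : ∀ i j, H.Adj (![a, b, c, d, e] i) (![a, b, c, d, e] j) ↔ p2p3.Adj i j := by
    intro i j
    fin_cases i <;> fin_cases j <;>
      simp [p2p3, hab, hcd, hde, hce, hac, had, hae, hbc, hbd, hbe, H.adj_comm b a,
        H.adj_comm c a, H.adj_comm c b, H.adj_comm d a, H.adj_comm d b, H.adj_comm d c,
        H.adj_comm e a, H.adj_comm e b, H.adj_comm e c, H.adj_comm e d]
  have hinj : Function.Injective ![a, b, c, d, e] := by
    have h1 := hab.ne
    have h2 := hcd.ne
    have h3 := hde.ne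
    have h4 : a ≠ c := by rintro rfl; exact had hcd
    have h5 : a ≠ d := by rintro rfl; exact hac hcd.symm
    have h6 : a ≠ e := by rintro rfl; exact had hde.symm
    have h7 : b ≠ c := by rintro rfl; exact hbd hcd
    have h8 : b ≠ d := by rintro rfl; exact hbc hcd.symm
    have h9 : b ≠ e := by rintro rfl; exact hbd hde.symm
    intro i j
    fin_cases i <;> fin_cases j <;> simp [*, Ne.symm, h1.symm, h2.symm, h3.symm, h4.symm,
      h5.symm, h6.symm, h7.symm, h8.symm, h9.symm, hne.symm]
  exact ⟨⟨⟨_, hinj⟩, hadj _ _⟩⟩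

theorem not_adj_of_common_neighbor {V : Type*} {H : SimpleGraph V} (htriangle : H.CliqueFree 3)
    {x y z : V} (hx : H.Adj x z) (hy : H.Adj y z) : ¬ H.Adj x y := by
  classical
  intro hxy
  exact htriangle {x, y, z} (is3Clique_triple_iff.mpr ⟨hxy, hx, hy⟩)

/-- A vertex of `B_i` has at most one non-neighbor in `B_{i+1}`. -/
theorem eq_of_not_adj_succ {V : Type*} {H : SimpleGraph V} {v : Fin 5 → V}
    (hC5 : ∀ i j : Fin 5, H.Adj (v i) (v j) ↔ (j = i + 1 ∨ i = j + 1))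
    (htriangle : H.CliqueFree 3) (hP2P3 : ¬ Nonempty (p2p3 ↪g H)) {i : Fin 5} {x y z : V}
    (hx : x ∈ Bset H v i) (hy : y ∈ Bset H v (i + 1)) (hz : z ∈ Bset H v (i + 1))
    (hxy : ¬ H.Adj x y) (hxz : ¬ H.Adj x z) : y = z := by
  by_contra hne
  have hyi : H.Adj y (v (i + 2)) := (hy.2 _).2 (by clear * -; revert i; decide)
  have hzi : H.Adj z (v (i + 2)) := (hz.2 _).2 (by clear * -; revert i; decide)
  refine not_edge_and_path hP2P3 (a := x) (b := v (i - 1)) ((hx.2 _).2 (Or.inl rfl)) hyi hzi.symm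
    (not_adj_of_common_neighbor htriangle hyi hzi) hne hxy ?_ hxz ?_ ?_ ?_
  · rw [hx.2]; clear * -; revert i; decide
  · rw [H.adj_comm, hy.2]; clear * -; revert i; decide
  · rw [hC5]; clear * -; revert i; decide
  · rw [H.adj_comm, hz.2]; clear * -; revert i; decide

/-- A vertex of `B_{i+1}` has at most one non-neighbor in `B_i`. -/
theorem eq_of_not_adj_pred {V : Type*} {H : SimpleGraph V} {v : Fin 5 → V}
    (hC5 : ∀ i j : Fin 5, H.Adj (v i) (v j) ↔ (j = i + 1 ∨ i = j + 1))
    (htriangle : H.CliqueFree 3) (hP2P3 : ¬ Nonempty (p2p3 ↪g H)) {i : Fin 5} {x y z : V}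
    (hx : x ∈ Bset H v (i + 1)) (hy : y ∈ Bset H v i) (hz : z ∈ Bset H v i)
    (hxy : ¬ H.Adj x y) (hxz : ¬ H.Adj x z) : y = z := by
  by_contra hne
  have hyi : H.Adj y (v (i - 1)) := (hy.2 _).2 (Or.inl rfl)
  have hzi : H.Adj z (v (i - 1)) := (hz.2 _).2 (Or.inl rfl)
  refine not_edge_and_path hP2P3 (a := x) (b := v (i + 2))
    ((hx.2 _).2 (by clear * -; revert i; decide)) hyi hzi.symm
    (not_adj_of_common_neighbor htriangle hyi hzi) hne hxy ?_ hxz ?_ ?_ ?_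
  · rw [hx.2]; clear * -; revert i; decide
  · rw [H.adj_comm, hy.2]; clear * -; revert i; decide
  · rw [hC5]; clear * -; revert i; decide
  · rw [H.adj_comm, hz.2]; clear * -; revert i; decide

/-- If `a j` and `c j` count the vertices of an independent set in `B_j` and at `v_j`, the local
constraints on these counts bound their sum. -/
theorem sum_le_of_local_constraints {t : ℕ} (a c : Fin 5 → ℕ) (hat : ∀ j, a j ≤ t)
    (haa : ∀ j, 0 < a j → 0 < a (j + 1) → a j ≤ 1 ∧ a (j + 1) ≤ 1 ∧ 2 ≤ t)
    (hcc : ∀ j, c j + c (j + 1) ≤ 1)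
    (hca : ∀ j, 0 < c j → a (j + 1) = 0) (hac : ∀ j, 0 < c (j + 1) → a j = 0) :
    ∑ j, (a j + c j) ≤ 2 * t + 2 := by
  simp only [Fin.forall_fin_succ, Fin.sum_univ_five, IsEmpty.forall_iff, and_true] at *
  simp at *
  have h1 : (2 : Fin 5) + 1 = 3 := rfl
  have h2 : (3 : Fin 5) + 1 = 4 := rfl
  have h3 : (4 : Fin 5) + 1 = 0 := rfl
  simp only [h1, h2, h3] at *
  omega

theorem stmt19 {V : Type*} [Fintype V] (H : SimpleGraph V) (v : Fin 5 → V)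
    (hinj : Function.Injective v)
    (hC5 : ∀ i j : Fin 5, H.Adj (v i) (v j) ↔ (j = i + 1 ∨ i = j + 1))
    (htriangle : H.CliqueFree 3)
    (hP2P3 : ¬ Nonempty (p2p3 ↪g H))
    (t : ℕ) (ht : 1 ≤ t)
    (hcover : ∀ x : V, x ∈ S0 v ∨ ∃ j : Fin 5, x ∈ Bset H v j)
    (hsize : ∀ j : Fin 5, (Bset H v j).ncard = t)
    (hedge : ∀ j : Fin 5, ∃ b ∈ Bset H v j, ∃ b' ∈ Bset H v (j + 1), H.Adj b b')
    : (∃ s : Set V, (∀ x ∈ s, ∀ y ∈ s, ¬ H.Adj x y) ∧ s.ncard = 2 * t + 2) ∧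
      (∀ s : Set V, (∀ x ∈ s, ∀ y ∈ s, ¬ H.Adj x y) → s.ncard ≤ 2 * t + 2) := by
  constructor
  · have hB : ∀ x ∈ Bset H v 0, H.Adj x (v 1) := fun x hx => (hx.2 1).2 (by decide)
    have hB' : ∀ x ∈ Bset H v 2, H.Adj x (v 1) := fun x hx => (hx.2 1).2 (by decide)
    have hB0 : ∀ x ∈ Bset H v 0, ¬ H.Adj x (v 0) ∧ ¬ H.Adj x (v 2) := fun x hx => by
      rw [hx.2, hx.2]; decide
    have hB2 : ∀ x ∈ Bset H v 2, ¬ H.Adj x (v 0) ∧ ¬ H.Adj x (v 2) := fun x hx => by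
      rw [hx.2, hx.2]; decide
    have hv : ¬ H.Adj (v 0) (v 2) := by rw [hC5]; decide
    have hB_v1 : ∀ x ∈ Bset H v 0 ∪ Bset H v 2, H.Adj x (v 1) := by
      rintro x (hx | hx)
      exacts [hB x hx, hB' x hx]
    have hB_v : ∀ x ∈ Bset H v 0 ∪ Bset H v 2, ¬ H.Adj x (v 0) ∧ ¬ H.Adj x (v 2) := by
      rintro x (hx | hx)
      exacts [hB0 x hx, hB2 x hx]
    refine ⟨(Bset H v 0 ∪ Bset H v 2) ∪ {v 0, v 2}, ?_, ?_⟩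
    · rintro x (hx | rfl | rfl) y (hy | rfl | rfl)
      · exact not_adj_of_common_neighbor htriangle (hB_v1 x hx) (hB_v1 y hy)
      · exact (hB_v x hx).1
      · exact (hB_v x hx).2
      · exact fun h => (hB_v y hy).1 h.symm
      · exact H.irrefl
      · exact hv
      · exact fun h => (hB_v y hy).2 h.symm
      · exact fun h => hv h.symm
      · exact H.irrefl
    · rw [Set.ncard_union_eq, Set.ncard_union_eq, hsize, hsize, Set.ncard_pair]
      · omega
      · exact hinj.ne (by decide)
      · exact Set.disjoint_left.2 fun x hx hx' =>
          absurd ((hx'.2 3).2 (by decide)) (by rw [hx.2]; decide)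
      · refine Set.disjoint_left.2 ?_
        rintro x (hx | hx) (rfl | rfl) <;> exact hx.1 ⟨_, rfl⟩
  · intro s hs
    have hcov : s = ⋃ j : Fin 5, (s ∩ Bset H v j) ∪ (s ∩ {v j}) := by
      ext x
      simp only [Set.mem_iUnion]
      constructor
      · intro hx
        rcases hcover x with ⟨j, rfl⟩ | ⟨j, hj⟩
        exacts [⟨j, Or.inr ⟨hx, rfl⟩⟩, ⟨j, Or.inl ⟨hx, hj⟩⟩]
      · rintro ⟨j, hx | hx⟩ <;> exact hx.1
    have hmemB : ∀ j, 0 < (s ∩ Bset H v j).ncard → ∃ x ∈ s, x ∈ Bset H v j := fun j h =>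
      Set.nonempty_of_ncard_ne_zero h.ne'
    have hmemv : ∀ j, 0 < (s ∩ {v j}).ncard → v j ∈ s := fun j h => by
      obtain ⟨x, hx, rfl⟩ := Set.nonempty_of_ncard_ne_zero h.ne'
      exact hx
    have hsub : s.ncard ≤ ∑ j, ((s ∩ Bset H v j).ncard + (s ∩ {v j}).ncard) := by
      conv_lhs => rw [hcov]
      exact (Set.ncard_iUnion_le_of_fintype _).trans
        (Finset.sum_le_sum fun j _ => Set.ncard_union_le _ _)
    refine hsub.trans (sum_le_of_local_constraints _ _ ?_ ?_ ?_ ?_ ?_)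
    · exact fun j => (Set.ncard_le_ncard Set.inter_subset_right).trans (hsize j).le
    · intro j h h'
      obtain ⟨x, hxs, hx⟩ := hmemB _ h
      obtain ⟨y, hys, hy⟩ := hmemB _ h'
      refine ⟨(Set.ncard_le_one_iff (Set.toFinite _)).2 fun {p q} hp hq => ?_,
        (Set.ncard_le_one_iff (Set.toFinite _)).2 fun {p q} hp hq => ?_, ?_⟩
      · exact eq_of_not_adj_pred hC5 htriangle hP2P3 hy hp.2 hq.2 (hs _ hys _ hp.1)
          (hs _ hys _ hq.1)
      · exact eq_of_not_adj_succ hC5 htriangle hP2P3 hx hp.2 hq.2 (hs _ hxs _ hp.1)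
          (hs _ hxs _ hq.1)
      · by_contra hlt
        obtain ⟨b, hb, b', hb', hadj⟩ := hedge j
        have h1 : ∀ k, (Bset H v k).ncard ≤ 1 := fun k => by rw [hsize]; omega
        rw [(Set.ncard_le_one_iff (Set.toFinite _)).1 (h1 _) hb hx,
          (Set.ncard_le_one_iff (Set.toFinite _)).1 (h1 _) hb' hy] at hadj
        exact hs x hxs y hys hadj
    · intro j
      have h1 : ∀ k, (s ∩ {v k}).ncard ≤ 1 := fun k =>
        (Set.ncard_le_ncard Set.inter_subset_right).trans (Set.ncard_singleton _).le
      by_contra hlt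
      have := h1 j
      have := h1 (j + 1)
      exact hs _ (hmemv j (by omega)) _ (hmemv (j + 1) (by omega)) ((hC5 _ _).2 (Or.inl rfl))
    · intro j h
      by_contra h0
      obtain ⟨x, hxs, hx⟩ := hmemB _ (Nat.pos_of_ne_zero h0)
      exact hs _ hxs _ (hmemv j h) ((hx.2 _).2 (Or.inl (by simp)))
    · intro j h
      by_contra h0
      obtain ⟨x, hxs, hx⟩ := hmemB _ (Nat.pos_of_ne_zero h0)
      exact hs _ hxs _ (hmemv _ h) ((hx.2 _).2 (Or.inr rfl))
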